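/- Gap-adjusted bound (Proposition 2). Let S be a nonempty finite scenario set, X a nonempty set of first-stage solutions, f : X → ℝ with f(x) ≥ 0, and Q : X × S → ℝ with Q(x,s) ≥ 0. Let 0 ≤ p ≤ P < 1, let D ⊆ S, and suppose (x̃, z̃) is a master solution of MAS_D with gap p, i.e., z̃ ≥ 0, Q(x̃,s) ≤ z̃ for all s ∈ D, and f(x̃) + z̃ ≤ (1/(1−p))·OPT_D. If Q(x̃,s) ≤ ((1−p)/(1−P))·z̃ + ((P−p)/(1−P))·f(x̃) for all s ∈ S, then f(x̃) + max_{s∈S} Q(x̃,s) ≤ (1/(1−P))·OPT_S, i.e., x̃ is a solution of the two-stage robust problem with gap P. -/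

import Mathlib

open Finset

/-- Maximum of the second-stage costs over a finite scenario subset,
with the maximum over the empty set defined as `0`. -/
noncomputable def masterMax {X σ : Type*} (Q : X → σ → ℝ) (D : Finset σ) (x : X) : ℝ :=
  if h : D.Nonempty then D.sup' h (Q x) else 0

/-- Optimal value of the master problem `MAS_D`. -/
noncomputable def OPT {X σ : Type*} (f : X → ℝ) (Q : X → σ → ℝ) (D : Finset σ) : ℝ :=
  ⨅ x : X, (f x + masterMax Q D x)

theorem masterMax_nonneg {X σ : Type*} (Q : X → σ → ℝ) (hQ : ∀ x s, 0 ≤ Q x s)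
    (D : Finset σ) (x : X) : 0 ≤ masterMax Q D x := by
  unfold masterMax
  split_ifs with h
  · obtain ⟨s, hs⟩ := h
    exact (hQ x s).trans (Finset.le_sup' (Q x) hs)
  · exact le_rfl

theorem masterMax_mono {X σ : Type*} (Q : X → σ → ℝ) (hQ : ∀ x s, 0 ≤ Q x s)
    {D S : Finset σ} (hD : D ⊆ S) (x : X) : masterMax Q D x ≤ masterMax Q S x := by
  by_cases h : D.Nonempty
  · simp only [masterMax, h, h.mono hD, dif_pos]
    exact Finset.sup'_mono (Q x) hD h
  · simpa only [masterMax, h, dif_neg, not_false_eq_true] using masterMax_nonneg Q hQ S x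

theorem OPT_mono {X σ : Type*} (f : X → ℝ) (Q : X → σ → ℝ)
    (hf : ∀ x, 0 ≤ f x) (hQ : ∀ x s, 0 ≤ Q x s)
    {D S : Finset σ} (hD : D ⊆ S) : OPT f Q D ≤ OPT f Q S := by
  refine ciInf_mono ⟨0, ?_⟩ fun x => by gcongr; exact masterMax_mono Q hQ hD x
  rintro _ ⟨x, rfl⟩
  exact add_nonneg (hf x) (masterMax_nonneg Q hQ D x)

/-- Proposition 2 (gap-adjusted bound). -/
theorem gap_adjusted_bound {X σ : Type*} [Nonempty X]
    (S : Finset σ) (hS : S.Nonempty)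
    (f : X → ℝ) (Q : X → σ → ℝ)
    (hf : ∀ x, 0 ≤ f x) (hQ : ∀ x s, 0 ≤ Q x s)
    (p P : ℝ) (hp0 : 0 ≤ p) (hpP : p ≤ P) (hP1 : P < 1)
    (D : Finset σ) (hD : D ⊆ S)
    (xt : X) (zt : ℝ) (hzt : 0 ≤ zt)
    (hmaster : ∀ s ∈ D, Q xt s ≤ zt)
    (hgap : f xt + zt ≤ (1 / (1 - p)) * OPT f Q D)
    (hall : ∀ s ∈ S, Q xt s ≤ ((1 - p) / (1 - P)) * zt + ((P - p) / (1 - P)) * f xt) :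
    f xt + S.sup' hS (Q xt) ≤ (1 / (1 - P)) * OPT f Q S := by
  have hP : 0 < 1 - P := by linarith
  have hp : 0 < 1 - p := by linarith
  have hopt : (1 - p) * (f xt + zt) ≤ OPT f Q S := by
    rw [one_div, ← div_eq_inv_mul, le_div_iff₀ hp] at hgap
    have hmono := OPT_mono f Q hf hQ hD
    linarith
  have hsup : S.sup' hS (Q xt) ≤
      ((1 - p) / (1 - P)) * zt + ((P - p) / (1 - P)) * f xt :=
    Finset.sup'_le hS _ hall
  calc f xt + S.sup' hS (Q xt)
      ≤ f xt + (((1 - p) / (1 - P)) * zt + ((P - p) / (1 - P)) * f xt) := by gcongr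
    _ = (1 / (1 - P)) * ((1 - p) * (f xt + zt)) := by field_simp; ring
    _ ≤ (1 / (1 - P)) * OPT f Q S := by gcongr
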